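/- Let Q be a finite abelian group of m×m unitary complex matrices, let φ ∈ ℂ^m, and suppose the vectors {Uφ : U ∈ Q} span ℂ^m, so that the frame operator S = Σ_{U ∈ Q} (Uφ)(Uφ)* is Hermitian positive definite. Let T be the unique Hermitian positive definite matrix with T² = S (so T = S^{1/2}), and set μ = T⁻¹φ. Then the canonical tight frame vectors satisfy T⁻¹(Uφ) = Uμ for all U ∈ Q, and they form a normalized tight frame: Σ_{U ∈ Q} (Uμ)(Uμ)* = I. That is, the canonical tight frame associated with a geometrically uniform frame is geometrically uniform with the same generating group Q and generating vector μ = S^{-1/2}φ. -/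

import Mathlib

open Matrix
open scoped ComplexOrder

open scoped MatrixOrder in
lemma aux_sqrt_unique {m : ℕ} (A B : Matrix (Fin m) (Fin m) ℂ) (hA : A.PosSemidef)
    (hB : B.PosSemidef) (h : A * A = B * B) : A = B := by
  have h1 := CFC.sqrt_unique (a := B * B) h hA.nonneg
  have h2 := CFC.sqrt_unique (a := B * B) rfl hB.nonneg
  exact h1.symm.trans h2

lemma aux_conj {m : ℕ} (A : Matrix (Fin m) (Fin m) ℂ) (x : Fin m → ℂ) :
    vecMulVec (A *ᵥ x) (star (A *ᵥ x)) = A * vecMulVec x (star x) * Aᴴ := by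
  rw [mul_vecMulVec, vecMulVec_mul, star_mulVec]

/-- Let `{Uφ : U ∈ Q}` be a geometrically uniform frame spanning `ℂ^m` with
(positive definite) frame operator `S`, and let `T` be the unique Hermitian positive
definite square root of `S`. With `μ = T⁻¹φ`, the canonical tight frame vectors satisfy
`T⁻¹(Uφ) = Uμ` for all `U ∈ Q`, and `∑_{U ∈ Q} (Uμ)(Uμ)* = I`: the canonical tight frame
is geometrically uniform with generating group `Q` and generating vector `μ = S^{-1/2}φ`. -/
theorem stmt_7 {m : ℕ} (hm : 0 < m)
    (Q : Subgroup (Matrix.unitaryGroup (Fin m) ℂ)) [Fintype Q]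
    (habelian : ∀ U V : Q, U * V = V * U)
    (φ : Fin m → ℂ)
    (hspan : Submodule.span ℂ
      (Set.range fun U : Q => (U : Matrix (Fin m) (Fin m) ℂ) *ᵥ φ) = ⊤)
    (S : Matrix (Fin m) (Fin m) ℂ)
    (hS : S = ∑ U : Q, vecMulVec ((U : Matrix (Fin m) (Fin m) ℂ) *ᵥ φ)
          (star ((U : Matrix (Fin m) (Fin m) ℂ) *ᵥ φ)))
    (T : Matrix (Fin m) (Fin m) ℂ)
    (hT : T.PosDef)
    (hTsq : T * T = S)
    (μ : Fin m → ℂ)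
    (hμ : μ = T⁻¹ *ᵥ φ) :
    (∀ U : Q, T⁻¹ *ᵥ ((U : Matrix (Fin m) (Fin m) ℂ) *ᵥ φ)
        = (U : Matrix (Fin m) (Fin m) ℂ) *ᵥ μ) ∧
    ∑ U : Q, vecMulVec ((U : Matrix (Fin m) (Fin m) ℂ) *ᵥ μ)
        (star ((U : Matrix (Fin m) (Fin m) ℂ) *ᵥ μ)) = (1 : Matrix (Fin m) (Fin m) ℂ) := by
  have hdet : IsUnit T.det := (Matrix.isUnit_iff_isUnit_det T).1 hT.isUnit
  have hunit : ∀ V : Q, (V : Matrix (Fin m) (Fin m) ℂ)ᴴ * (V : Matrix (Fin m) (Fin m) ℂ) = 1 :=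
    fun V => (Matrix.mem_unitaryGroup_iff').1 V.1.2
  have hSc : ∀ V : Q, (V : Matrix (Fin m) (Fin m) ℂ) * S * (V : Matrix (Fin m) (Fin m) ℂ)ᴴ = S := by
    intro V
    rw [hS, Finset.mul_sum, Finset.sum_mul]
    refine Fintype.sum_equiv (Equiv.mulLeft V) _ _ fun U => ?_
    rw [← aux_conj, mulVec_mulVec]
    simp
  have hTc : ∀ V : Q, (V : Matrix (Fin m) (Fin m) ℂ) * T * (V : Matrix (Fin m) (Fin m) ℂ)ᴴ = T := by
    intro V
    refine aux_sqrt_unique _ _ (hT.posSemidef.mul_mul_conjTranspose_same _) hT.posSemidef ?_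
    rw [hTsq, ← hSc V, ← hTsq]
    simp only [Matrix.mul_assoc]
    rw [← Matrix.mul_assoc (V : Matrix (Fin m) (Fin m) ℂ)ᴴ, hunit, Matrix.one_mul]
  have hcomm : ∀ V : Q, (V : Matrix (Fin m) (Fin m) ℂ) * T = T * (V : Matrix (Fin m) (Fin m) ℂ) := by
    intro V
    conv_rhs => rw [← hTc V]
    rw [Matrix.mul_assoc _ _ (V : Matrix (Fin m) (Fin m) ℂ), hunit, Matrix.mul_one]
  have key : ∀ U : Q, T⁻¹ *ᵥ ((U : Matrix (Fin m) (Fin m) ℂ) *ᵥ φ)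
        = (U : Matrix (Fin m) (Fin m) ℂ) *ᵥ μ := by
    intro U
    rw [hμ, mulVec_mulVec, mulVec_mulVec]
    congr 1
    calc T⁻¹ * (U : Matrix (Fin m) (Fin m) ℂ)
        = T⁻¹ * ((U : Matrix (Fin m) (Fin m) ℂ) * T) * T⁻¹ := by
          rw [Matrix.mul_assoc, Matrix.mul_assoc, Matrix.mul_nonsing_inv _ hdet, Matrix.mul_one]
      _ = (U : Matrix (Fin m) (Fin m) ℂ) * T⁻¹ := by
          rw [hcomm, ← Matrix.mul_assoc, Matrix.nonsing_inv_mul _ hdet, Matrix.one_mul]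
  refine ⟨key, ?_⟩
  simp_rw [← key, aux_conj T⁻¹]
  rw [← Finset.sum_mul, ← Finset.mul_sum, ← hS, ← hTsq, hT.isHermitian.inv.eq,
    ← Matrix.mul_assoc, Matrix.nonsing_inv_mul _ hdet, Matrix.one_mul,
    Matrix.mul_nonsing_inv _ hdet]
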